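/- Under the hypotheses of Theorem 1 (f = Σ f_i with each f_i convex and L_i-smooth, h* proper closed convex, bounded delays τ_k^i ∈ {0,…,T}, existence of a saddle point of L(x,y) = f(x) + ⟨Kx,y⟩ − h*(y), extrapolated PD-PIAG iteration x_{k+1} = x_k − σ Σ_i ∇f_i(x_{k−τ_k^i}) − σKᵀ(2y_k − y_{k−1}), y_{k+1} = Prox_{τ h*}(y_k + τ K x_{k+1}), and step sizes with √(τσ)‖K‖ + σL(T+1)² < 1), the full iterate sequence converges: there exists a saddle point (x*, y*) of L such that x_k → x* and y_k → y*. -/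

import Mathlib

open scoped RealInnerProductSpace
open Filter Topology

noncomputable section

/-- `L`-smoothness of a real-valued function, in the sense of assumption A1:
differentiability together with the two-sided quadratic bound. -/
def LSmooth {d : ℕ} (g : EuclideanSpace ℝ (Fin d) → ℝ) (L : ℝ) : Prop :=
  Differentiable ℝ g ∧
    ∀ x y : EuclideanSpace ℝ (Fin d),
      |g y - g x - ⟪gradient g x, y - x⟫| ≤ L / 2 * ‖y - x‖ ^ 2

/-- Assumption B1: `δ`-strong convexity in the weak sense (`δ` may be negative). -/
def WeakStrConvex {d : ℕ} (g : EuclideanSpace ℝ (Fin d) → ℝ) (δ : ℝ) : Prop :=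
  ∀ x y : EuclideanSpace ℝ (Fin d),
    g x + ⟪gradient g x, y - x⟫ + δ / 2 * ‖y - x‖ ^ 2 ≤ g y

/-- Properness of an `EReal`-valued function: finite somewhere and never `⊥`. -/
def EProper {d : ℕ} (g : EuclideanSpace ℝ (Fin d) → EReal) : Prop :=
  (∃ z, g z ≠ ⊤) ∧ ∀ z, g z ≠ ⊥

/-- Convexity of an `EReal`-valued function. -/
def EConvexFn {d : ℕ} (g : EuclideanSpace ℝ (Fin d) → EReal) : Prop :=
  ∀ z w : EuclideanSpace ℝ (Fin d), ∀ a b : ℝ, 0 ≤ a → 0 ≤ b → a + b = 1 →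
    g (a • z + b • w) ≤ (a : EReal) * g z + (b : EReal) * g w

/-- Assumption B2: `γ`-strong convexity of an `EReal`-valued function, stated via
subgradients: for every subgradient `v` of `g` at `z` one has the quadratic lower bound. -/
def EStrongConvexFn {d : ℕ} (g : EuclideanSpace ℝ (Fin d) → EReal) (γ : ℝ) : Prop :=
  ∀ z v : EuclideanSpace ℝ (Fin d),
    (∀ u, g z + ((⟪v, u - z⟫ : ℝ) : EReal) ≤ g u) →
      ∀ u, g z + ((⟪v, u - z⟫ + γ / 2 * ‖u - z‖ ^ 2 : ℝ) : EReal) ≤ g u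

/-- `p = Prox_g(z)`: `p` minimizes `u ↦ g u + ‖u - z‖² / 2`. -/
def IsProxPt {d : ℕ} (g : EuclideanSpace ℝ (Fin d) → EReal)
    (z p : EuclideanSpace ℝ (Fin d)) : Prop :=
  ∀ u, g p + ((‖p - z‖ ^ 2 / 2 : ℝ) : EReal) ≤ g u + ((‖u - z‖ ^ 2 / 2 : ℝ) : EReal)

/-- The Lagrangian `L(x, y) = f x + ⟪K x, y⟫ - h*(y)`, valued in `EReal`. -/
def Lagr {d₁ d₂ : ℕ} (f : EuclideanSpace ℝ (Fin d₁) → ℝ)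
    (hstar : EuclideanSpace ℝ (Fin d₂) → EReal)
    (K : EuclideanSpace ℝ (Fin d₁) →L[ℝ] EuclideanSpace ℝ (Fin d₂))
    (x : EuclideanSpace ℝ (Fin d₁)) (y : EuclideanSpace ℝ (Fin d₂)) : EReal :=
  (f x : EReal) + ((⟪K x, y⟫ : ℝ) : EReal) - hstar y

/-- `(xh, yh)` is a saddle point of `Lg`. -/
def IsSaddlePt {d₁ d₂ : ℕ}
    (Lg : EuclideanSpace ℝ (Fin d₁) → EuclideanSpace ℝ (Fin d₂) → EReal)
    (xh : EuclideanSpace ℝ (Fin d₁)) (yh : EuclideanSpace ℝ (Fin d₂)) : Prop :=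
  ∀ (x : EuclideanSpace ℝ (Fin d₁)) (y : EuclideanSpace ℝ (Fin d₂)),
    Lg xh y ≤ Lg xh yh ∧ Lg xh yh ≤ Lg x yh


theorem aux_limit {A B C : ℝ} (h : ∀ t : ℝ, 0 < t → t ≤ 1 → A ≤ B + t * C) : A ≤ B := by
  by_contra hlt
  push Not at hlt
  have h1 := h 1 one_pos le_rfl
  have hC : 0 < C := by linarith
  have ht : 0 < (A - B) / (2 * C) := by apply div_pos <;> linarith
  have h2 := h ((A - B) / (2 * C)) ht (by rw [div_le_one (by linarith)]; linarith)
  have h3 : (A - B) / (2 * C) * C = (A - B) / 2 := by field_simp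
  linarith

theorem aux_grad {d : ℕ} (g : EuclideanSpace ℝ (Fin d) → ℝ) (L : ℝ)
    (hc : ConvexOn ℝ Set.univ g) (hs : LSmooth g L) (z u : EuclideanSpace ℝ (Fin d)) :
    g z + ⟪gradient g z, u - z⟫ ≤ g u := by
  apply aux_limit (C := L / 2 * ‖u - z‖ ^ 2)
  intro t ht ht1
  have h1 := hc.2 (Set.mem_univ z) (Set.mem_univ u) (sub_nonneg.2 ht1) ht.le (by ring)
  have h2 := (abs_le.1 (hs.2 z ((1 - t) • z + t • u))).1
  have h3 : (1 - t) • z + t • u - z = t • (u - z) := by module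
  rw [h3, inner_smul_right, norm_smul, Real.norm_of_nonneg ht.le] at h2
  simp only [smul_eq_mul] at h1
  have h4 : t * (g z + ⟪gradient g z, u - z⟫) ≤ t * (g u + t * (L / 2 * ‖u - z‖ ^ 2)) := by
    nlinarith
  exact le_of_mul_le_mul_left h4 ht

theorem aux_prox {d : ℕ} (h : EuclideanSpace ℝ (Fin d) → EReal) (hp : EProper h)
    (hc : EConvexFn h) (τ : ℝ) (hτ : 0 < τ) (z p : EuclideanSpace ℝ (Fin d))
    (hpr : IsProxPt (fun u => (τ : EReal) * h u) z p) :
    h p ≠ ⊤ ∧ ∀ u, h u ≠ ⊤ →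
      (h p).toReal + (1 / τ) * ⟪z - p, u - p⟫ ≤ (h u).toReal := by
  have hfin : h p ≠ ⊤ := by
    intro htop
    obtain ⟨w, hw⟩ := hp.1
    have := hpr w
    lift h w to ℝ using ⟨hw, hp.2 w⟩ with hw' 
    simp only [htop] at this
    rw [EReal.coe_mul_top_of_pos hτ, EReal.top_add_coe] at this
    norm_cast at this
  refine ⟨hfin, fun u hu => ?_⟩
  obtain ⟨P, hP⟩ : ∃ P : ℝ, h p = P := ⟨_, (EReal.coe_toReal hfin (hp.2 p)).symm⟩
  obtain ⟨U, hU⟩ : ∃ U : ℝ, h u = U := ⟨_, (EReal.coe_toReal hu (hp.2 u)).symm⟩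
  rw [hP, hU]
  simp only [EReal.toReal_coe]
  apply aux_limit (C := 1 / τ * (‖u - p‖ ^ 2 / 2))
  intro t ht ht1
  have h1 := hc p u (1 - t) t (by linarith) ht.le (by ring)
  rw [hP, hU] at h1
  have h2 := hpr ((1 - t) • p + t • u)
  have hv : h ((1 - t) • p + t • u) ≠ ⊤ := by
    intro e
    rw [e] at h1
    norm_cast at h1
  obtain ⟨V, hV⟩ : ∃ V : ℝ, h ((1 - t) • p + t • u) = V :=
    ⟨_, (EReal.coe_toReal hv (hp.2 _)).symm⟩
  simp only [hP, hV] at h1 h2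
  norm_cast at h1 h2
  have h3 : (1 - t) • p + t • u - z = (p - z) + t • (u - p) := by module
  rw [h3, norm_add_sq_real, inner_smul_right, norm_smul, Real.norm_of_nonneg ht.le] at h2
  have h5 : ⟪p - z, u - p⟫ = - ⟪z - p, u - p⟫ := by
    rw [← inner_neg_left]; congr 1; abel
  rw [h5] at h2
  have h6 : τ * V ≤ τ * ((1 - t) * P + t * U) := mul_le_mul_of_nonneg_left h1 hτ.le
  have h4 : (τ * t) * (P + 1 / τ * ⟪z - p, u - p⟫) ≤
      (τ * t) * (U + t * (1 / τ * (‖u - p‖ ^ 2 / 2))) := by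
    have e1 : (τ * t) * (P + 1 / τ * ⟪z - p, u - p⟫) = τ * t * P + t * ⟪z - p, u - p⟫ := by
      field_simp
    have e2 : (τ * t) * (U + t * (1 / τ * (‖u - p‖ ^ 2 / 2))) =
      τ * t * U + t ^ 2 * ‖u - p‖ ^ 2 / 2 := by
      field_simp
    rw [e1, e2]
    nlinarith
  exact le_of_mul_le_mul_left h4 (by positivity)

theorem aux_saddle {d₁ d₂ : ℕ} (F : EuclideanSpace ℝ (Fin d₁) → ℝ)
    (h : EuclideanSpace ℝ (Fin d₂) → EReal) (hp : EProper h)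
    (K : EuclideanSpace ℝ (Fin d₁) →L[ℝ] EuclideanSpace ℝ (Fin d₂))
    (xs : EuclideanSpace ℝ (Fin d₁)) (ys : EuclideanSpace ℝ (Fin d₂)) :
    IsSaddlePt (Lagr F h K) xs ys ↔ (h ys ≠ ⊤ ∧ ∀ x y, h y ≠ ⊤ →
      F xs + ⟪K xs, y⟫ - (h y).toReal ≤ F x + ⟪K x, ys⟫ - (h ys).toReal) := by
  have key : ∀ x y, h y ≠ ⊤ →
      Lagr F h K x y = ((F x + ⟪K x, y⟫ - (h y).toReal : ℝ) : EReal) := by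
    intro x y hy
    unfold Lagr
    conv_lhs => rw [← EReal.coe_toReal hy (hp.2 y)]
    norm_cast
  have keytop : ∀ x y, h y = ⊤ → Lagr F h K x y = ⊥ := by
    intro x y hy
    unfold Lagr
    rw [hy, EReal.sub_top]
  constructor
  · intro hs
    have hfin : h ys ≠ ⊤ := by
      intro htop
      obtain ⟨w, hw⟩ := hp.1
      have := (hs xs w).1
      rw [keytop _ _ htop, key _ _ hw, le_bot_iff] at this
      exact EReal.coe_ne_bot _ this
    refine ⟨hfin, fun x y hy => ?_⟩
    have := (hs x y).1.trans (hs x y).2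
    rw [key _ _ hy, key _ _ hfin] at this
    exact_mod_cast this
  · rintro ⟨hfin, hs⟩ x y
    constructor
    · by_cases hy : h y = ⊤
      · rw [keytop _ _ hy]; exact bot_le
      · rw [key _ _ hy, key _ _ hfin]
        exact_mod_cast hs xs y hy
    · rw [key _ _ hfin, key _ _ hfin]
      exact_mod_cast hs x ys hfin

theorem aux_cross {E F : Type*} [NormedAddCommGroup E] [InnerProductSpace ℝ E]
    [NormedAddCommGroup F] [InnerProductSpace ℝ F] (K : E →L[ℝ] F) (σ τ : ℝ) (hσ : 0 < σ)
    (hτ : 0 < τ) (u : E) (v : F) :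
    |⟪K u, v⟫| ≤ (Real.sqrt (τ * σ) * ‖K‖) * (‖u‖ ^ 2 / (2 * σ) + ‖v‖ ^ 2 / (2 * τ)) := by
  have h1 : |⟪K u, v⟫| ≤ ‖K‖ * ‖u‖ * ‖v‖ :=
    (abs_real_inner_le_norm _ _).trans (mul_le_mul_of_nonneg_right (K.le_opNorm u) (norm_nonneg _))
  refine h1.trans ?_
  rw [Real.sqrt_mul hτ.le]
  obtain ⟨s, hs, rfl⟩ : ∃ s, 0 < s ∧ σ = s ^ 2 :=
    ⟨Real.sqrt σ, Real.sqrt_pos.2 hσ, (Real.sq_sqrt hσ.le).symm⟩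
  obtain ⟨t, ht, rfl⟩ : ∃ s, 0 < s ∧ τ = s ^ 2 :=
    ⟨Real.sqrt τ, Real.sqrt_pos.2 hτ, (Real.sq_sqrt hτ.le).symm⟩
  rw [Real.sqrt_sq hs.le, Real.sqrt_sq ht.le]
  have e : t * s * ‖K‖ * (‖u‖ ^ 2 / (2 * s ^ 2) + ‖v‖ ^ 2 / (2 * t ^ 2)) - ‖K‖ * ‖u‖ * ‖v‖
    = ‖K‖ * (t * ‖u‖ - s * ‖v‖) ^ 2 / (2 * s * t) := by
    field_simp
    ring
  have : 0 ≤ ‖K‖ * (t * ‖u‖ - s * ‖v‖) ^ 2 / (2 * s * t) := by positivity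
  linarith

theorem aux_window {E : Type*} [NormedAddCommGroup E] (x : ℤ → E) (T m : ℕ) (hm : m ≤ T) (k : ℤ) :
    ‖x (k + 1) - x (k - m)‖ ^ 2 ≤
      ((T : ℝ) + 1) * ∑ s ∈ Finset.range (T + 1), ‖x (k - s + 1) - x (k - s)‖ ^ 2 := by
  have h1 : x (k + 1) - x (k - m) = ∑ s ∈ Finset.range (m + 1), (x (k - s + 1) - x (k - s)) := by
    clear hm
    induction m with
    | zero => simp
    | succ m ih =>
      rw [Finset.sum_range_succ, ← ih]
      push_cast
      rw [show k - (m + 1 : ℤ) + 1 = k - m by ring]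
      abel
  have h2 : ‖x (k + 1) - x (k - m)‖ ≤
      ∑ s ∈ Finset.range (T + 1), ‖x (k - s + 1) - x (k - s)‖ := by
    rw [h1]
    refine (norm_sum_le _ _).trans ?_
    apply Finset.sum_le_sum_of_subset_of_nonneg
    · intro s hs
      simp only [Finset.mem_range] at *
      omega
    · intros; positivity
  refine (pow_le_pow_left₀ (norm_nonneg _) h2 2).trans ?_
  refine sq_sum_le_card_mul_sum_sq.trans ?_
  simp

theorem aux_pot (a : ℤ → ℝ) (T : ℕ) (k : ℤ) :
    (∑ s ∈ Finset.range (T + 1), ∑ m ∈ Finset.range s, a (k - m)) +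
      ∑ s ∈ Finset.range (T + 1), a (k - s) =
    (∑ s ∈ Finset.range (T + 1), ∑ m ∈ Finset.range s, a (k - 1 - m)) + ((T : ℝ) + 1) * a k := by
  have h : ∀ s : ℕ, (∑ m ∈ Finset.range s, a (k - m)) + a (k - s) =
      (∑ m ∈ Finset.range s, a (k - 1 - m)) + a k := by
    intro s
    induction s with
    | zero => simp
    | succ s ih =>
      rw [Finset.sum_range_succ, Finset.sum_range_succ, ih]
      push_cast
      rw [show k - (s + 1 : ℤ) = k - 1 - s by ring]
      ring
  rw [← Finset.sum_add_distrib, Finset.sum_congr rfl (fun s _ => h s), Finset.sum_add_distrib]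
  simp

theorem aux_step
    (d₁ d₂ N T : ℕ)
    (f : Fin N → EuclideanSpace ℝ (Fin d₁) → ℝ) (Lc : Fin N → ℝ)
    (hL : ∀ i, 0 ≤ Lc i)
    (hconv : ∀ i, ConvexOn ℝ Set.univ (f i))
    (hsmooth : ∀ i, LSmooth (f i) (Lc i))
    (hstar : EuclideanSpace ℝ (Fin d₂) → EReal)
    (hproper : EProper hstar) (hconvh : EConvexFn hstar)
    (K : EuclideanSpace ℝ (Fin d₁) →L[ℝ] EuclideanSpace ℝ (Fin d₂))
    (σ τ : ℝ) (hσ : 0 < σ) (hτ : 0 < τ)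
    (x : ℤ → EuclideanSpace ℝ (Fin d₁)) (y : ℤ → EuclideanSpace ℝ (Fin d₂))
    (dly : ℤ → Fin N → ℕ) (hdly : ∀ (k : ℤ) (i : Fin N), dly k i ≤ T)
    (k : ℤ)
    (hxiter : 
      x (k + 1) = x k - σ • (∑ i, gradient (f i) (x (k - (dly k i : ℤ))))
        - σ • (ContinuousLinearMap.adjoint K) ((2 : ℝ) • y k - y (k - 1)))
    (hyiter : 
      IsProxPt (fun u => (τ : EReal) * hstar u) (y k + τ • K (x (k + 1))) (y (k + 1)))
    (x' : EuclideanSpace ℝ (Fin d₁)) (y' : EuclideanSpace ℝ (Fin d₂)) (hy' : hstar y' ≠ ⊤) :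
    (∑ i, f i (x (k + 1))) + ⟪K (x (k + 1)), y'⟫ - (hstar y').toReal -
      ((∑ i, f i x') + ⟪K x', y (k + 1)⟫ - (hstar (y (k + 1))).toReal) ≤
    1 / σ * ⟪x k - x (k + 1), x (k + 1) - x'⟫ + 1 / τ * ⟪y k - y (k + 1), y (k + 1) - y'⟫
     + ((∑ i, Lc i) * ((T : ℝ) + 1) / 2) *
        (∑ s ∈ Finset.range (T + 1), ‖x (k - s + 1) - x (k - s)‖ ^ 2)
     + ⟪K (x (k + 1) - x'), (y (k + 1) - y k) - (y k - y (k - 1))⟫ := by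
  set S := ∑ s ∈ Finset.range (T + 1), ‖x (k - s + 1) - x (k - s)‖ ^ 2 with hS
  have hf : ∀ i, f i (x (k + 1)) - f i x' ≤
      ⟪gradient (f i) (x (k - (dly k i : ℤ))), x (k + 1) - x'⟫
        + Lc i * (((T : ℝ) + 1) / 2 * S) := by
    intro i
    have h1 := aux_grad (f i) (Lc i) (hconv i) (hsmooth i) (x (k - (dly k i : ℤ))) x'
    have h2 := (abs_le.1 ((hsmooth i).2 (x (k - (dly k i : ℤ))) (x (k + 1)))).2
    have h3 := aux_window x T (dly k i) (hdly k i) k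
    rw [← hS] at h3
    have h4 := mul_le_mul_of_nonneg_left h3 (hL i)
    have h5 : ⟪gradient (f i) (x (k - (dly k i : ℤ))), x (k + 1) - x'⟫ =
      ⟪gradient (f i) (x (k - (dly k i : ℤ))), x (k + 1) - x (k - (dly k i : ℤ))⟫ -
      ⟪gradient (f i) (x (k - (dly k i : ℤ))), x' - x (k - (dly k i : ℤ))⟫ := by
      rw [← inner_sub_right]; congr 1; abel
    rw [h5]
    linarith
  have hF := Finset.sum_le_sum (fun i (_ : i ∈ Finset.univ) => hf i)
  rw [Finset.sum_sub_distrib, Finset.sum_add_distrib, ← Finset.sum_mul, ← sum_inner] at hF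
  set g := ∑ i, gradient (f i) (x (k - (dly k i : ℤ))) with hg
  have hgeq : g = (1 / σ) • (x k - x (k + 1)) -
      (ContinuousLinearMap.adjoint K) ((2 : ℝ) • y k - y (k - 1)) := by
    rw [hxiter]
    have : x k - (x k - σ • g - σ • (ContinuousLinearMap.adjoint K) ((2 : ℝ) • y k - y (k - 1)))
      = σ • (g + (ContinuousLinearMap.adjoint K) ((2 : ℝ) • y k - y (k - 1))) := by
      rw [smul_add]; abel
    rw [this, smul_smul, one_div, inv_mul_cancel₀ hσ.ne', one_smul]
    abel
  rw [hgeq, inner_sub_left, real_inner_smul_left, ContinuousLinearMap.adjoint_inner_left] at hF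
  have hH := (aux_prox hstar hproper hconvh τ hτ _ _ hyiter).2 y' hy'
  have e1 : 1 / τ * ⟪y k + τ • K (x (k + 1)) - y (k + 1), y' - y (k + 1)⟫ =
     - (1 / τ * ⟪y k - y (k + 1), y (k + 1) - y'⟫) + ⟪K (x (k + 1)), y' - y (k + 1)⟫ := by
    rw [show y k + τ • K (x (k + 1)) - y (k + 1) = (y k - y (k + 1)) + τ • K (x (k + 1)) by abel,
      inner_add_left, real_inner_smul_left, ← neg_sub y' (y (k+1)), inner_neg_right]
    field_simp
  rw [e1] at hH
  simp only [map_sub, inner_sub_left, inner_sub_right,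
    real_inner_smul_left] at hH hF ⊢
  rw [real_inner_comm (K (x (k+1))) (y k), real_inner_comm (K (x (k+1))) (y (k-1)), real_inner_comm (K x') (y k), real_inner_comm (K x') (y (k-1))] at hF
  linarith

/-- The Lyapunov function of the iteration. -/
def lyapV {d₁ d₂ : ℕ} (K : EuclideanSpace ℝ (Fin d₁) →L[ℝ] EuclideanSpace ℝ (Fin d₂))
    (σ τ r c : ℝ) (T : ℕ)
    (x : ℤ → EuclideanSpace ℝ (Fin d₁)) (y : ℤ → EuclideanSpace ℝ (Fin d₂))
    (xs : EuclideanSpace ℝ (Fin d₁)) (ys : EuclideanSpace ℝ (Fin d₂)) (k : ℤ) : ℝ :=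
  ‖x k - xs‖ ^ 2 / (2 * σ) + ‖y k - ys‖ ^ 2 / (2 * τ) - ⟪K (x k - xs), y k - y (k - 1)⟫
    + r * (‖y k - y (k - 1)‖ ^ 2 / (2 * τ))
    + c * ∑ s ∈ Finset.range (T + 1), ∑ m ∈ Finset.range s,
        ‖x (k - 1 - m + 1) - x (k - 1 - m)‖ ^ 2

theorem lyapV_lower {d₁ d₂ : ℕ} (K : EuclideanSpace ℝ (Fin d₁) →L[ℝ] EuclideanSpace ℝ (Fin d₂))
    (σ τ c : ℝ) (T : ℕ) (hσ : 0 < σ) (hτ : 0 < τ) (hc : 0 ≤ c)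
    (x : ℤ → EuclideanSpace ℝ (Fin d₁)) (y : ℤ → EuclideanSpace ℝ (Fin d₂))
    (xs : EuclideanSpace ℝ (Fin d₁)) (ys : EuclideanSpace ℝ (Fin d₂)) (k : ℤ) :
    (1 - Real.sqrt (τ * σ) * ‖K‖) * (‖x k - xs‖ ^ 2 / (2 * σ)) + ‖y k - ys‖ ^ 2 / (2 * τ)
      ≤ lyapV K σ τ (Real.sqrt (τ * σ) * ‖K‖) c T x y xs ys k := by
  unfold lyapV
  have h1 := (abs_le.1 (aux_cross K σ τ hσ hτ (x k - xs) (y k - y (k - 1)))).2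
  have h2 : 0 ≤ c * ∑ s ∈ Finset.range (T + 1), ∑ m ∈ Finset.range s,
        ‖x (k - 1 - m + 1) - x (k - 1 - m)‖ ^ 2 := by positivity
  linarith

theorem aux_three {E : Type*} [NormedAddCommGroup E] [InnerProductSpace ℝ E] (σ : ℝ) (hσ : 0 < σ)
    (a b c : E) : 1 / σ * ⟪a - b, b - c⟫ =
      ‖a - c‖ ^ 2 / (2 * σ) - ‖b - c‖ ^ 2 / (2 * σ) - ‖b - a‖ ^ 2 / (2 * σ) := by
  rw [show a - c = (a - b) + (b - c) by abel, norm_add_sq_real, norm_sub_rev b a]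
  field_simp
  ring

theorem lyapV_step {d₁ d₂ : ℕ} (K : EuclideanSpace ℝ (Fin d₁) →L[ℝ] EuclideanSpace ℝ (Fin d₂))
    (σ τ L : ℝ) (T : ℕ) (hσ : 0 < σ) (hτ : 0 < τ)
    (x : ℤ → EuclideanSpace ℝ (Fin d₁)) (y : ℤ → EuclideanSpace ℝ (Fin d₂))
    (xs : EuclideanSpace ℝ (Fin d₁)) (ys : EuclideanSpace ℝ (Fin d₂)) (k : ℤ)
    (h : 0 ≤ 1 / σ * ⟪x k - x (k + 1), x (k + 1) - xs⟫ + 1 / τ * ⟪y k - y (k + 1), y (k + 1) - ys⟫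
     + (L * ((T : ℝ) + 1) / 2) *
        (∑ s ∈ Finset.range (T + 1), ‖x (k - s + 1) - x (k - s)‖ ^ 2)
     + ⟪K (x (k + 1) - xs), (y (k + 1) - y k) - (y k - y (k - 1))⟫) :
    lyapV K σ τ (Real.sqrt (τ * σ) * ‖K‖) (L * ((T : ℝ) + 1) / 2) T x y xs ys (k + 1)
      + ((1 - (Real.sqrt (τ * σ) * ‖K‖ + σ * L * ((T : ℝ) + 1) ^ 2)) / (2 * σ)
          * ‖x (k + 1) - x k‖ ^ 2
        + (1 - Real.sqrt (τ * σ) * ‖K‖) / (2 * τ) * ‖y (k + 1) - y k‖ ^ 2)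
    ≤ lyapV K σ τ (Real.sqrt (τ * σ) * ‖K‖) (L * ((T : ℝ) + 1) / 2) T x y xs ys k := by
  unfold lyapV
  have h1 := (abs_le.1 (aux_cross K σ τ hσ hτ (x (k + 1) - x k) (y k - y (k - 1)))).1
  rw [aux_three σ hσ, aux_three τ hτ] at h
  have hp := aux_pot (fun k => ‖x (k + 1) - x k‖ ^ 2) T k
  simp only at hp
  rw [show k + 1 - 1 = k by ring]
  have e : ⟪K (x (k + 1) - xs), (y (k + 1) - y k) - (y k - y (k - 1))⟫ =
     ⟪K (x (k + 1) - xs), y (k + 1) - y k⟫ - ⟪K (x k - xs), y k - y (k - 1)⟫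
      - ⟪K (x (k + 1) - x k), y k - y (k - 1)⟫ := by
    simp only [map_sub, inner_sub_left, inner_sub_right]; ring
  rw [e] at h
  have hp' := congrArg (fun z => L * ((T : ℝ) + 1) / 2 * z) hp
  simp only [mul_add] at hp'
  have e2 : (1 - (Real.sqrt (τ * σ) * ‖K‖ + σ * L * ((T : ℝ) + 1) ^ 2)) / (2 * σ)
          * ‖x (k + 1) - x k‖ ^ 2 = ‖x (k + 1) - x k‖ ^ 2 / (2 * σ) - 
       Real.sqrt (τ * σ) * ‖K‖ * (‖x (k + 1) - x k‖ ^ 2 / (2 * σ)) -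
      L * ((T : ℝ) + 1) / 2 * (((T : ℝ) + 1) * ‖x (k + 1) - x k‖ ^ 2) := by
    field_simp
    ring
  have e3 : (1 - Real.sqrt (τ * σ) * ‖K‖) / (2 * τ) * ‖y (k + 1) - y k‖ ^ 2 =
     ‖y (k + 1) - y k‖ ^ 2 / (2 * τ) -
       Real.sqrt (τ * σ) * ‖K‖ * (‖y (k + 1) - y k‖ ^ 2 / (2 * τ)) := by
    ring
  rw [e2, e3]
  simp only [mul_add] at h1 h ⊢
  linarith

theorem aux_descent (V d : ℕ → ℝ) (hV : ∀ n, 0 ≤ V n) (hd : ∀ n, 0 ≤ d n)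
    (h : ∀ n, V (n + 1) + d n ≤ V n) : Tendsto d atTop (𝓝 0) := by
  have hanti : Antitone V := antitone_nat_of_succ_le fun n => by linarith [h n, hd n]
  have hconv := tendsto_atTop_ciInf hanti ⟨0, by rintro _ ⟨n, rfl⟩; exact hV n⟩
  have h2 : Tendsto (fun n => V n - V (n + 1)) atTop (𝓝 0) := by
    simpa using hconv.sub (hconv.comp (tendsto_add_atTop_nat 1))
  exact squeeze_zero hd (fun n => by linarith [h n]) h2

theorem aux_sq_zero {E : Type*} [NormedAddCommGroup E] {ι : Type*} {l : Filter ι} (u : ι → E)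
    (c : ℝ) (hc : 0 < c) (h : Tendsto (fun n => c * ‖u n‖ ^ 2) l (𝓝 0)) : Tendsto u l (𝓝 0) := by
  rw [tendsto_zero_iff_norm_tendsto_zero]
  have h1 : Tendsto (fun n => ‖u n‖ ^ 2) l (𝓝 0) := by
    have := h.const_mul c⁻¹
    simpa [← mul_assoc, inv_mul_cancel₀ hc.ne'] using this
  have := h1.sqrt
  simpa using this

theorem aux_main
    (d₁ d₂ N T : ℕ)
    (f : Fin N → EuclideanSpace ℝ (Fin d₁) → ℝ) (Lc : Fin N → ℝ)
    (hL : ∀ i, 0 ≤ Lc i)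
    (hconv : ∀ i, ConvexOn ℝ Set.univ (f i))
    (hsmooth : ∀ i, LSmooth (f i) (Lc i))
    (hstar : EuclideanSpace ℝ (Fin d₂) → EReal)
    (hproper : EProper hstar) (hlsc : LowerSemicontinuous hstar) (hconvh : EConvexFn hstar)
    (K : EuclideanSpace ℝ (Fin d₁) →L[ℝ] EuclideanSpace ℝ (Fin d₂))
    (σ τ : ℝ) (hσ : 0 < σ) (hτ : 0 < τ)
    (x : ℤ → EuclideanSpace ℝ (Fin d₁)) (y : ℤ → EuclideanSpace ℝ (Fin d₂))
    (dly : ℤ → Fin N → ℕ) (hdly : ∀ (k : ℤ) (i : Fin N), dly k i ≤ T)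
    (hxiter : ∀ k : ℤ, 0 ≤ k →
      x (k + 1) = x k - σ • (∑ i, gradient (f i) (x (k - (dly k i : ℤ))))
        - σ • (ContinuousLinearMap.adjoint K) ((2 : ℝ) • y k - y (k - 1)))
    (hyiter : ∀ k : ℤ, 0 ≤ k →
      IsProxPt (fun u => (τ : EReal) * hstar u) (y k + τ • K (x (k + 1))) (y (k + 1)))
    (xh : EuclideanSpace ℝ (Fin d₁)) (yh : EuclideanSpace ℝ (Fin d₂))
    (hsaddle : IsSaddlePt (Lagr (fun z => ∑ i, f i z) hstar K) xh yh)
    (hstep : Real.sqrt (τ * σ) * ‖K‖ + σ * (∑ i, Lc i) * ((T : ℝ) + 1) ^ 2 < 1) :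
    ∃ (xs : EuclideanSpace ℝ (Fin d₁)) (ys : EuclideanSpace ℝ (Fin d₂)),
      IsSaddlePt (Lagr (fun z => ∑ i, f i z) hstar K) xs ys ∧
        Tendsto (fun k : ℕ => x (k : ℤ)) atTop (𝓝 xs) ∧
        Tendsto (fun k : ℕ => y (k : ℤ)) atTop (𝓝 ys) := by
  set r := Real.sqrt (τ * σ) * ‖K‖ with hr
  set L := ∑ i, Lc i with hLdef
  have hL0 : 0 ≤ L := Finset.sum_nonneg fun i _ => hL i
  have hr1 : r < 1 := by
    have : 0 ≤ σ * L * ((T : ℝ) + 1) ^ 2 := by positivity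
    linarith
  set c := L * ((T : ℝ) + 1) / 2 with hc
  have hc0 : 0 ≤ c := by positivity
  set δ₁ := (1 - (r + σ * L * ((T : ℝ) + 1) ^ 2)) / (2 * σ) with hδ₁
  set δ₂ := (1 - r) / (2 * τ) with hδ₂
  have hδ₁0 : 0 < δ₁ := by apply div_pos <;> linarith
  have hδ₂0 : 0 < δ₂ := by apply div_pos <;> linarith
  have hstepk := fun (k : ℤ) (hk : 0 ≤ k) => aux_step d₁ d₂ N T f Lc hL hconv hsmooth hstar
    hproper hconvh K σ τ hσ hτ x y dly hdly k (hxiter k hk) (hyiter k hk)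
  have hyfin : ∀ k : ℤ, 0 ≤ k → hstar (y (k + 1)) ≠ ⊤ := fun k hk =>
    (aux_prox hstar hproper hconvh τ hτ _ _ (hyiter k hk)).1
  -- Lyapunov descent at every saddle point
  have hdesc : ∀ xs ys, IsSaddlePt (Lagr (fun z => ∑ i, f i z) hstar K) xs ys → ∀ n : ℕ,
      lyapV K σ τ r c T x y xs ys ((n + 1 : ℕ) : ℤ) + (δ₁ * ‖x ((n : ℤ) + 1) - x n‖ ^ 2
        + δ₂ * ‖y ((n : ℤ) + 1) - y n‖ ^ 2) ≤ lyapV K σ τ r c T x y xs ys (n : ℤ) := by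
    intro xs ys hs n
    obtain ⟨hfin, hs⟩ := (aux_saddle _ hstar hproper K xs ys).1 hs
    have h1 := hstepk n (Int.natCast_nonneg n) xs ys hfin
    have h2 := hs (x ((n : ℤ) + 1)) (y ((n : ℤ) + 1)) (hyfin n (Int.natCast_nonneg n))
    have h3 := lyapV_step K σ τ L T hσ hτ x y xs ys n (by linarith)
    push_cast
    exact h3
  have hlow : ∀ xs ys (n : ℕ), (1 - r) * (‖x n - xs‖ ^ 2 / (2 * σ)) + ‖y n - ys‖ ^ 2 / (2 * τ)
      ≤ lyapV K σ τ r c T x y xs ys (n : ℤ) := fun xs ys n =>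
    lyapV_lower K σ τ c T hσ hτ hc0 x y xs ys n
  have hr1' : 0 < 1 - r := by linarith
  have hV0 : ∀ xs ys (n : ℕ), 0 ≤ lyapV K σ τ r c T x y xs ys (n : ℤ) := fun xs ys n =>
    le_trans (by positivity) (hlow xs ys n)
  have hanti : ∀ xs ys, IsSaddlePt (Lagr (fun z => ∑ i, f i z) hstar K) xs ys →
      Antitone fun n : ℕ => lyapV K σ τ r c T x y xs ys (n : ℤ) := fun xs ys hs =>
    antitone_nat_of_succ_le fun n => by
      have := hdesc xs ys hs n
      have h2 : 0 ≤ δ₁ * ‖x ((n : ℤ) + 1) - x n‖ ^ 2 + δ₂ * ‖y ((n : ℤ) + 1) - y n‖ ^ 2 := by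
        positivity
      linarith
  -- differences vanish
  have hd := aux_descent (fun n : ℕ => lyapV K σ τ r c T x y xh yh (n : ℤ))
    (fun n : ℕ => δ₁ * ‖x ((n : ℤ) + 1) - x n‖ ^ 2 + δ₂ * ‖y ((n : ℤ) + 1) - y n‖ ^ 2)
    (hV0 xh yh) (fun n => by positivity) (hdesc xh yh hsaddle)
  have hdx' : Tendsto (fun n : ℕ => x ((n : ℤ) + 1) - x n) atTop (𝓝 0) :=
    aux_sq_zero _ δ₁ hδ₁0 (squeeze_zero (fun n => by positivity)
      (fun n => le_add_of_nonneg_right (by positivity)) hd)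
  have hdy' : Tendsto (fun n : ℕ => y ((n : ℤ) + 1) - y n) atTop (𝓝 0) :=
    aux_sq_zero _ δ₂ hδ₂0 (squeeze_zero (fun n => by positivity)
      (fun n => le_add_of_nonneg_left (by positivity)) hd)
  have hdx : Tendsto (fun n : ℤ => x (n + 1) - x n) atTop (𝓝 0) := by
    rw [← Nat.map_cast_int_atTop, tendsto_map'_iff]; exact hdx'
  have hdy : Tendsto (fun n : ℤ => y (n + 1) - y n) atTop (𝓝 0) := by
    rw [← Nat.map_cast_int_atTop, tendsto_map'_iff]; exact hdy'
  -- boundedness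
  set V0 := lyapV K σ τ r c T x y xh yh ((0 : ℕ) : ℤ) with hV0def
  have hbx : ∀ n : ℕ, ‖x n - xh‖ ≤ Real.sqrt (V0 * (2 * σ) / (1 - r)) := by
    intro n
    apply Real.le_sqrt_of_sq_le
    have h1 := (hlow xh yh n).trans (hanti xh yh hsaddle (Nat.zero_le n))
    have h2 : 0 ≤ ‖y n - yh‖ ^ 2 / (2 * τ) := by positivity
    have h3 : (1 - r) * (‖x n - xh‖ ^ 2 / (2 * σ)) ≤ V0 := by
      simp only at h1
      rw [← hV0def] at h1
      linarith
    rw [le_div_iff₀ hr1', ← div_le_iff₀ (by positivity)]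
    calc _ = (1 - r) * (‖x n - xh‖ ^ 2 / (2 * σ)) := by ring
      _ ≤ _ := h3
  have hby : ∀ n : ℕ, ‖y n - yh‖ ≤ Real.sqrt (V0 * (2 * τ)) := by
    intro n
    apply Real.le_sqrt_of_sq_le
    have h1 := (hlow xh yh n).trans (hanti xh yh hsaddle (Nat.zero_le n))
    have h2 : 0 ≤ (1 - r) * (‖x n - xh‖ ^ 2 / (2 * σ)) := by positivity
    rw [← div_le_iff₀ (by positivity)]
    simp only at h1
    rw [← hV0def] at h1
    linarith
  obtain ⟨⟨xs, ys⟩, -, φ, hφ, hlim⟩ := tendsto_subseq_of_bounded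
    (x := fun n : ℕ => (x n, y n))
    (s := Metric.closedBall xh (Real.sqrt (V0 * (2 * σ) / (1 - r))) ×ˢ
      Metric.closedBall yh (Real.sqrt (V0 * (2 * τ))))
    (Metric.isBounded_closedBall.prod Metric.isBounded_closedBall)
    (fun n => ⟨by rw [Metric.mem_closedBall, dist_eq_norm]; exact hbx n,
      by rw [Metric.mem_closedBall, dist_eq_norm]; exact hby n⟩)
  have hxl : Tendsto (fun n => x (φ n : ℤ)) atTop (𝓝 xs) := (Prod.tendsto_iff _ _).1 hlim |>.1
  have hyl : Tendsto (fun n => y (φ n : ℤ)) atTop (𝓝 ys) := (Prod.tendsto_iff _ _).1 hlim |>.2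
  have hφt : Tendsto (fun n => (φ n : ℤ)) atTop atTop :=
    tendsto_natCast_atTop_atTop.comp hφ.tendsto_atTop
  have hφs : ∀ b : ℤ, Tendsto (fun n => (φ n : ℤ) - b) atTop atTop := fun b => by
    simpa [sub_eq_add_neg] using tendsto_atTop_add_const_right _ (-b) hφt
  have hdxb : ∀ b : ℤ, Tendsto (fun n => x ((φ n : ℤ) - b + 1) - x ((φ n : ℤ) - b)) atTop (𝓝 0) :=
    fun b => hdx.comp (hφs b)
  have hdyb : Tendsto (fun n => y (φ n : ℤ) - y ((φ n : ℤ) - 1)) atTop (𝓝 0) := by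
    have := hdy.comp (hφs 1)
    simpa [Function.comp_def] using this
  have hdx0 : Tendsto (fun n => x ((φ n : ℤ) + 1) - x (φ n : ℤ)) atTop (𝓝 0) := hdx.comp hφt
  have hdy0 : Tendsto (fun n => y ((φ n : ℤ) + 1) - y (φ n : ℤ)) atTop (𝓝 0) := hdy.comp hφt
  have hxl1 : Tendsto (fun n => x ((φ n : ℤ) + 1)) atTop (𝓝 xs) := by
    simpa using hdx0.add hxl
  have hyl1 : Tendsto (fun n => y ((φ n : ℤ) + 1)) atTop (𝓝 ys) := by
    simpa using hdy0.add hyl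
  have hFc : Continuous fun z => ∑ i, f i z :=
    continuous_finsetSum _ fun i _ => (hsmooth i).1.continuous
  -- the limit inequality, in additive form
  have hup : ∀ x' y', hstar y' ≠ ⊤ → hstar ys ≤
      (((∑ i, f i x') + ⟪K x', ys⟫ - ((∑ i, f i xs) + ⟪K xs, y'⟫ - (hstar y').toReal) : ℝ)
        : EReal) := by
    intro x' y' hy'
    set R : ℕ → ℝ := fun n =>
      ((∑ i, f i x') + ⟪K x', y ((φ n : ℤ) + 1)⟫ -
        ((∑ i, f i (x ((φ n : ℤ) + 1))) + ⟪K (x ((φ n : ℤ) + 1)), y'⟫ - (hstar y').toReal)) +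
      (1 / σ * ⟪x (φ n : ℤ) - x ((φ n : ℤ) + 1), x ((φ n : ℤ) + 1) - x'⟫
        + 1 / τ * ⟪y (φ n : ℤ) - y ((φ n : ℤ) + 1), y ((φ n : ℤ) + 1) - y'⟫
        + c * (∑ s ∈ Finset.range (T + 1),
            ‖x ((φ n : ℤ) - s + 1) - x ((φ n : ℤ) - s)‖ ^ 2)
        + ⟪K (x ((φ n : ℤ) + 1) - x'), (y ((φ n : ℤ) + 1) - y (φ n : ℤ))
            - (y (φ n : ℤ) - y ((φ n : ℤ) - 1))⟫) with hR
    have hRlim : Tendsto R atTop (𝓝 (((∑ i, f i x') + ⟪K x', ys⟫ -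
        ((∑ i, f i xs) + ⟪K xs, y'⟫ - (hstar y').toReal)) +
        (1 / σ * ⟪xs - xs, xs - x'⟫ + 1 / τ * ⟪ys - ys, ys - y'⟫
          + c * (∑ s ∈ Finset.range (T + 1), ‖(0 : EuclideanSpace ℝ (Fin d₁))‖ ^ 2)
          + ⟪K (xs - x'), (0 : EuclideanSpace ℝ (Fin d₂)) - 0⟫))) := by
      refine Tendsto.add ?_ ?_
      · refine (tendsto_const_nhds.add (tendsto_const_nhds.inner hyl1)).sub
          (((hFc.tendsto xs).comp hxl1 |>.add
            (((K.continuous.tendsto xs).comp hxl1).inner tendsto_const_nhds)).sub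
              tendsto_const_nhds)
      · refine Tendsto.add (Tendsto.add (Tendsto.add ?_ ?_) ?_) ?_
        · exact ((hxl.sub hxl1).inner (hxl1.sub tendsto_const_nhds)).const_mul _
        · exact ((hyl.sub hyl1).inner (hyl1.sub tendsto_const_nhds)).const_mul _
        · exact (tendsto_finsetSum _ fun (s : ℕ) _ => ((hdxb (s : ℤ)).norm.pow 2)).const_mul _
        · exact ((K.continuous.tendsto _).comp (hxl1.sub tendsto_const_nhds)).inner
            (hdy0.sub hdyb)
    simp only [sub_self, inner_zero_left, inner_zero_right, norm_zero, mul_zero, add_zero,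
      ne_eq, OfNat.ofNat_ne_zero, not_false_eq_true, zero_pow, Finset.sum_const_zero] at hRlim
    have hle : ∀ n, hstar (y ((φ n : ℤ) + 1)) ≤ (R n : EReal) := by
      intro n
      have h1 := hstepk (φ n) (Int.natCast_nonneg _) x' y' hy'
      rw [← EReal.coe_toReal (hyfin (φ n) (Int.natCast_nonneg _)) (hproper.2 _)]
      rw [EReal.coe_le_coe_iff]
      rw [← hLdef, ← hc] at h1
      simp only [hR]
      linarith
    have hRE := (continuous_coe_real_ereal.tendsto _).comp hRlim
    have := (hlsc ys)
    by_contra hcon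
    push Not at hcon
    obtain ⟨m, hm1, hm2⟩ := exists_between hcon
    have e1 := hyl1.eventually (hlsc ys m hm2)
    have e2 := hRE.eventually (gt_mem_nhds hm1)
    obtain ⟨n, hn1, hn2⟩ := (e1.and e2).exists
    exact absurd (hle n) (not_le.2 (lt_trans hn2 hn1))
  have hysfin : hstar ys ≠ ⊤ := by
    obtain ⟨w, hw⟩ := hproper.1
    exact ne_top_of_le_ne_top (EReal.coe_ne_top _) (hup xh w hw)
  have hs : IsSaddlePt (Lagr (fun z => ∑ i, f i z) hstar K) xs ys := by
    rw [aux_saddle _ hstar hproper]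
    refine ⟨hysfin, fun x' y' hy' => ?_⟩
    have := hup x' y' hy'
    rw [← EReal.coe_toReal hysfin (hproper.2 _), EReal.coe_le_coe_iff] at this
    linarith
  -- the Lyapunov function tends to zero
  have hVsub : Tendsto (fun n => lyapV K σ τ r c T x y xs ys (φ n : ℤ)) atTop (𝓝
      (‖xs - xs‖ ^ 2 / (2 * σ) + ‖ys - ys‖ ^ 2 / (2 * τ)
        - ⟪K (xs - xs), (0 : EuclideanSpace ℝ (Fin d₂))⟫
        + r * (‖(0 : EuclideanSpace ℝ (Fin d₂))‖ ^ 2 / (2 * τ))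
        + c * ∑ s ∈ Finset.range (T + 1), ∑ m ∈ Finset.range s,
          ‖(0 : EuclideanSpace ℝ (Fin d₁))‖ ^ 2)) := by
    unfold lyapV
    refine Tendsto.add (Tendsto.add (Tendsto.sub (Tendsto.add ?_ ?_) ?_) ?_) ?_
    · exact ((hxl.sub tendsto_const_nhds).norm.pow 2).div_const _
    · exact ((hyl.sub tendsto_const_nhds).norm.pow 2).div_const _
    · exact ((K.continuous.tendsto _).comp (hxl.sub tendsto_const_nhds)).inner hdyb
    · exact ((hdyb.norm.pow 2).div_const _).const_mul _
    · refine (tendsto_finsetSum _ fun s _ => tendsto_finsetSum _ fun m _ => ?_).const_mul _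
      have := (hdxb (1 + m)).norm.pow 2
      simpa only [sub_sub] using this
  simp only [sub_self, map_zero, inner_zero_left, inner_zero_right, norm_zero, mul_zero, add_zero,
      ne_eq, OfNat.ofNat_ne_zero, not_false_eq_true, zero_pow, Finset.sum_const_zero,
      zero_div] at hVsub
  have hVall : Tendsto (fun n : ℕ => lyapV K σ τ r c T x y xs ys (n : ℤ)) atTop (𝓝 0) := by
    have h1 := tendsto_atTop_ciInf (hanti xs ys hs) ⟨0, by rintro _ ⟨n, rfl⟩; exact hV0 xs ys n⟩
    have h2 := tendsto_nhds_unique (h1.comp hφ.tendsto_atTop) hVsub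
    rwa [h2] at h1
  refine ⟨xs, ys, hs, ?_, ?_⟩
  · rw [← tendsto_sub_nhds_zero_iff]
    refine aux_sq_zero _ ((1 - r) / (2 * σ)) (by positivity)
      (squeeze_zero (fun n => by positivity) (fun n => ?_) hVall)
    refine le_trans ?_ (hlow xs ys n)
    have h2 : 0 ≤ ‖y n - ys‖ ^ 2 / (2 * τ) := by positivity
    have h3 : (1 - r) / (2 * σ) * ‖x n - xs‖ ^ 2 = (1 - r) * (‖x n - xs‖ ^ 2 / (2 * σ)) := by ring
    linarith
  · rw [← tendsto_sub_nhds_zero_iff]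
    refine aux_sq_zero _ (1 / (2 * τ)) (by positivity)
      (squeeze_zero (fun n => by positivity) (fun n => ?_) hVall)
    refine le_trans ?_ (hlow xs ys n)
    have h2 : 0 ≤ (1 - r) * (‖x n - xs‖ ^ 2 / (2 * σ)) := by positivity
    have h3 : 1 / (2 * τ) * ‖y n - ys‖ ^ 2 = ‖y n - ys‖ ^ 2 / (2 * τ) := by ring
    linarith

/-- Theorem 1 (iii): convergence of the extrapolated PD-PIAG iterates to a
saddle point. -/
theorem stmt_9
    (d₁ d₂ N T : ℕ)
    (f : Fin N → EuclideanSpace ℝ (Fin d₁) → ℝ) (Lc : Fin N → ℝ)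
    (hconv : ∀ i, ConvexOn ℝ Set.univ (f i))
    (hsmooth : ∀ i, LSmooth (f i) (Lc i))
    (hstar : EuclideanSpace ℝ (Fin d₂) → EReal)
    (hproper : EProper hstar) (hlsc : LowerSemicontinuous hstar) (hconvh : EConvexFn hstar)
    (K : EuclideanSpace ℝ (Fin d₁) →L[ℝ] EuclideanSpace ℝ (Fin d₂))
    (σ τ : ℝ) (hσ : 0 < σ) (hτ : 0 < τ)
    (x : ℤ → EuclideanSpace ℝ (Fin d₁)) (y : ℤ → EuclideanSpace ℝ (Fin d₂))
    (hx0 : ∀ k : ℤ, k ≤ 0 → x k = x 0) (hy0 : ∀ k : ℤ, k ≤ 0 → y k = y 0)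
    (dly : ℤ → Fin N → ℕ) (hdly : ∀ (k : ℤ) (i : Fin N), dly k i ≤ T)
    (hxiter : ∀ k : ℤ, 0 ≤ k →
      x (k + 1) = x k - σ • (∑ i, gradient (f i) (x (k - (dly k i : ℤ))))
        - σ • (ContinuousLinearMap.adjoint K) ((2 : ℝ) • y k - y (k - 1)))
    (hyiter : ∀ k : ℤ, 0 ≤ k →
      IsProxPt (fun u => (τ : EReal) * hstar u) (y k + τ • K (x (k + 1))) (y (k + 1)))
    (xh : EuclideanSpace ℝ (Fin d₁)) (yh : EuclideanSpace ℝ (Fin d₂))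
    (hsaddle : IsSaddlePt (Lagr (fun z => ∑ i, f i z) hstar K) xh yh)
    (hstep : Real.sqrt (τ * σ) * ‖K‖ + σ * (∑ i, Lc i) * ((T : ℝ) + 1) ^ 2 < 1)
 :
    ∃ (xs : EuclideanSpace ℝ (Fin d₁)) (ys : EuclideanSpace ℝ (Fin d₂)),
      IsSaddlePt (Lagr (fun z => ∑ i, f i z) hstar K) xs ys ∧
        Tendsto (fun k : ℕ => x (k : ℤ)) atTop (𝓝 xs) ∧
        Tendsto (fun k : ℕ => y (k : ℤ)) atTop (𝓝 ys) := by
  rcases Nat.eq_zero_or_pos d₁ with h0 | hpos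
  · subst h0
    have hK : K = 0 := by
      ext1 z
      rw [Subsingleton.elim z 0]; simp
    refine aux_main 0 d₂ N T f (fun _ => 0) (fun _ => le_rfl) hconv (fun i => ⟨(hsmooth i).1, ?_⟩)
      hstar hproper hlsc hconvh K σ τ hσ hτ x y dly hdly hxiter hyiter xh yh hsaddle ?_
    · intro u v
      rw [Subsingleton.elim v u]
      simp
    · simp [hK]
  · refine aux_main d₁ d₂ N T f Lc (fun i => ?_) hconv hsmooth
      hstar hproper hlsc hconvh K σ τ hσ hτ x y dly hdly hxiter hyiter xh yh hsaddle hstep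
    have h1 := (abs_nonneg _).trans
      ((hsmooth i).2 0 (EuclideanSpace.single (⟨0, hpos⟩ : Fin d₁) (1 : ℝ)))
    simp at h1
    linarith
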